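/- For polytopes P₁,...,P_n ⊂ ℝⁿ and λ₁,...,λ_n ≥ 0, the function Q(λ₁,...,λ_n) = Vol(λ₁P₁ + ⋯ + λ_nP_n) is a homogeneous polynomial of degree n in λ₁,...,λ_n with nonnegative coefficients. -/

import Mathlib

open MeasureTheory Pointwise

section LinearProgram

variable {J : Type*} [Fintype J]

/-- A set `S` of coordinates is an optimal support for minimising `w` over the nonnegative points
of the cosets of `K` if `w` is nonnegative on every direction of `K` that is feasible at a
nonnegative point with support `S`. -/
def IsOptimalSupport (K : Submodule ℝ (J → ℝ)) (w : Module.Dual ℝ (J → ℝ)) (S : Set J) : Prop :=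
  ∀ k ∈ K, (∀ j ∉ S, 0 ≤ k j) → 0 ≤ w k

/-- A functional is generic for `K` if it vanishes on the vectors of `K` supported in `U` only when
there is no nonzero such vector. -/
def IsGenericFor (K : Submodule ℝ (J → ℝ)) (w : Module.Dual ℝ (J → ℝ)) : Prop :=
  ∀ U : Set J, (∃ k ∈ K, k ≠ 0 ∧ Function.support k ⊆ U) →
    ∃ k ∈ K, Function.support k ⊆ U ∧ w k ≠ 0

theorem exists_isGenericFor (K : Submodule ℝ (J → ℝ)) : ∃ w, IsGenericFor K w := by
  classical
  let I := {U : Set J // ∃ k ∈ K, k ≠ 0 ∧ Function.support k ⊆ U}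
  choose v hvK hv hvU using fun U : I => U.2
  obtain ⟨w, hw⟩ := Module.exists_dual_forall_apply_ne_zero (K := ℝ) v hv
  exact ⟨w, fun U hU => ⟨v ⟨U, hU⟩, hvK _, hvU _, hw _⟩⟩

theorem exists_pos_nonneg_add_smul {t k : J → ℝ} (ht : 0 ≤ t) (hk : ∀ j, t j = 0 → 0 ≤ k j) :
    ∃ ε : ℝ, 0 < ε ∧ 0 ≤ t + ε • k := by
  have h : ∀ᶠ ε : ℝ in nhdsWithin 0 (Set.Ioi 0), ∀ j, 0 ≤ t j + ε * k j := by
    rw [Filter.eventually_all]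
    intro j
    rcases (ht j).eq_or_lt with h0 | h0
    · filter_upwards [self_mem_nhdsWithin] with ε hε
      have h1 : t j = 0 := h0.symm
      have := mul_nonneg (le_of_lt (Set.mem_Ioi.1 hε)) (hk j h1)
      linarith
    · have hc : Filter.Tendsto (fun ε : ℝ => t j + ε * k j) (nhds 0) (nhds (t j + 0 * k j)) :=
        Continuous.tendsto (by fun_prop) 0
      have : ∀ᶠ ε : ℝ in nhds 0, 0 < t j + ε * k j :=
        hc.eventually (lt_mem_nhds (by simpa using h0))
      exact (this.filter_mono nhdsWithin_le_nhds).mono fun _ h => h.le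
  obtain ⟨ε, hε, hpos⟩ := (h.and self_mem_nhdsWithin).exists
  exact ⟨ε, hpos, fun j => by simpa using hε j⟩

variable {K : Submodule ℝ (J → ℝ)} {w : Module.Dual ℝ (J → ℝ)}

theorem IsOptimalSupport.eq_zero_of_support_subset {S : Set J} (hS : IsOptimalSupport K w S)
    (hw : IsGenericFor K w) {k : J → ℝ} (hk : k ∈ K) (hkS : Function.support k ⊆ S) : k = 0 := by
  by_contra hne
  obtain ⟨v, hvK, hvS, hv⟩ := hw S ⟨k, hk, hne, hkS⟩
  have h0 : ∀ j ∉ S, v j = 0 := fun j hj => Function.notMem_support.1 fun h => hj (hvS h)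
  have h1 := hS v hvK fun j hj => (h0 j hj).ge
  have h2 := hS (-v) (K.neg_mem hvK) fun j hj => by simp [h0 j hj]
  rw [map_neg] at h2
  exact hv (by linarith)

theorem IsOptimalSupport.eq_of_sub_mem (hw : IsGenericFor K w) {t t' : J → ℝ} (ht : 0 ≤ t)
    (ht' : 0 ≤ t') (hS : IsOptimalSupport K w (Function.support t))
    (hS' : IsOptimalSupport K w (Function.support t')) (h : t' - t ∈ K) : t' = t := by
  by_contra hne
  have hsupp : Function.support (t' - t) ⊆ Function.support (t + t') := by
    intro j hj hj0
    have h1 : 0 ≤ t j := ht j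
    have h2 : 0 ≤ t' j := ht' j
    have h3 : t j + t' j = 0 := hj0
    exact hj (by simp only [Pi.sub_apply]; linarith)
  obtain ⟨v, hvK, hvS, hv⟩ := hw _ ⟨_, h, sub_ne_zero.2 hne, hsupp⟩
  have hwtt : w (t' - t) ≤ 0 := by
    have := hS' (t - t') (by simpa using K.neg_mem h) fun j hj => by
      rw [Pi.sub_apply, Function.notMem_support.1 hj, sub_zero]
      exact ht j
    rw [← neg_sub t t', map_neg]
    linarith
  have key : ∀ u ∈ K, Function.support u ⊆ Function.support (t + t') → 0 ≤ w u := by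
    intro u hu hus
    obtain ⟨ε, hε, hpos⟩ := exists_pos_nonneg_add_smul (t := t + t') (k := u) (add_nonneg ht ht')
      fun j hj => (Function.notMem_support.1 fun h' => hus h' hj).ge
    have := hS (t' - t + ε • u) (K.add_mem h (K.smul_mem _ hu)) fun j hj => by
      have h0 := hpos j
      have h1 : t j = 0 := Function.notMem_support.1 hj
      simp only [Pi.add_apply, Pi.sub_apply, Pi.zero_apply, h1] at h0 ⊢
      linarith
    rw [map_add, map_smul, smul_eq_mul] at this
    exact nonneg_of_mul_nonneg_right (by linarith : 0 ≤ ε * w u) hε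
  have h1 := key v hvK hvS
  have h2 := key (-v) (K.neg_mem hvK) (by simpa using hvS)
  rw [map_neg] at h2
  exact hv (by linarith)

theorem exists_isOptimalSupport (K : Submodule ℝ (J → ℝ)) (w : Module.Dual ℝ (J → ℝ))
    {t₀ : J → ℝ} (ht₀ : 0 ≤ t₀) (hK : Bornology.IsBounded {t : J → ℝ | 0 ≤ t ∧ t - t₀ ∈ K}) :
    ∃ t, 0 ≤ t ∧ t - t₀ ∈ K ∧ IsOptimalSupport K w (Function.support t) := by
  have hcl : IsClosed {t : J → ℝ | 0 ≤ t ∧ t - t₀ ∈ K} :=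
    (isClosed_le continuous_const continuous_id).inter
      (K.closed_of_finiteDimensional.preimage (continuous_id.sub continuous_const))
  obtain ⟨t, ⟨ht, htK⟩, hmin⟩ := (Metric.isCompact_of_isClosed_isBounded hcl hK).exists_isMinOn
    ⟨t₀, ht₀, by simp⟩ w.continuous_of_finiteDimensional.continuousOn
  refine ⟨t, ht, htK, fun k hk hpos => ?_⟩
  obtain ⟨ε, hε, hnn⟩ := exists_pos_nonneg_add_smul ht (k := k) fun j hj => hpos j (by simpa using hj)
  have := hmin (a := t + ε • k) ⟨hnn, by
    rw [add_sub_right_comm]; exact K.add_mem htK (K.smul_mem _ hk)⟩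
  simp only [Set.mem_ofPred_eq, map_add, map_smul, smul_eq_mul] at this
  exact nonneg_of_mul_nonneg_right (by linarith : 0 ≤ ε * w k) hε

end LinearProgram

section Cell

variable {ι J E : Type*} [DecidableEq ι] [Fintype J]

/-- The vector of sums of `t` over the fibres of `g`. -/
noncomputable def fiberSum (g : J → ι) : (J → ℝ) →ₗ[ℝ] (ι → ℝ) :=
  Fintype.linearCombination ℝ fun j => Pi.single (g j) 1

theorem fiberSum_apply (g : J → ι) (t : J → ℝ) (i : ι) :
    fiberSum g t i = ∑ j, if g j = i then t j else 0 := by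
  simp [fiberSum, Fintype.linearCombination_apply, Pi.single_apply, eq_comm]

theorem fiberSum_mul (g : J → ι) (l : ι → ℝ) (t : J → ℝ) :
    fiberSum g ((l ∘ g) * t) = l * fiberSum g t := by
  ext i
  rw [Pi.mul_apply, fiberSum_apply, fiberSum_apply, Finset.mul_sum]
  refine Finset.sum_congr rfl fun j _ => ?_
  split_ifs with h <;> simp [h]

/-- Nonnegative weights with prescribed fibre sums. -/
def fiberWeights (g : J → ι) (l : ι → ℝ) : Set (J → ℝ) := {t | 0 ≤ t ∧ fiberSum g t = l}

theorem isBounded_fiberWeights (g : J → ι) (l : ι → ℝ) :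
    Bornology.IsBounded (fiberWeights g l) := by
  refine (Metric.isBounded_Icc (0 : J → ℝ) (l ∘ g)).subset fun t ht => ⟨ht.1, fun j => ?_⟩
  rw [Function.comp_apply, ← ht.2, fiberSum_apply]
  have := Finset.single_le_sum (f := fun j' => if g j' = g j then t j' else 0)
    (fun j' _ => by split_ifs; exacts [ht.1 j', le_rfl]) (Finset.mem_univ j)
  simpa using this

theorem isClosed_fiberWeights (g : J → ι) (l : ι → ℝ) : IsClosed (fiberWeights g l) :=
  (isClosed_le continuous_const continuous_id).inter
    (isClosed_eq (fiberSum g).continuous_of_finiteDimensional continuous_const)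

theorem fiberWeights_support_eq_image (g : J → ι) {l : ι → ℝ} (hl : ∀ i, 0 < l i) (S : Set J) :
    {t ∈ fiberWeights g l | Function.support t = S} =
      ((l ∘ g) * ·) '' {t ∈ fiberWeights g 1 | Function.support t = S} := by
  have hs : ∀ (m : ι → ℝ), (∀ i, 0 < m i) → ∀ t : J → ℝ,
      Function.support ((m ∘ g) * t) = Function.support t := by
    intro m hm t
    ext j
    simp [(hm (g j)).ne']
  ext t
  constructor
  · rintro ⟨⟨ht, hG⟩, hS⟩
    refine ⟨(l⁻¹ ∘ g) * t, ⟨⟨fun j => ?_, ?_⟩, ?_⟩, ?_⟩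
    · exact mul_nonneg (inv_nonneg.2 (hl _).le) (ht j)
    · rw [fiberSum_mul, hG]
      ext i
      simp [(hl i).ne']
    · rw [hs l⁻¹ (fun i => inv_pos.2 (hl i)), hS]
    · ext j
      simp [(hl (g j)).ne']
  · rintro ⟨t, ⟨⟨ht, hG⟩, hS⟩, rfl⟩
    refine ⟨⟨fun j => mul_nonneg (hl _).le (ht j), ?_⟩, ?_⟩
    · rw [fiberSum_mul, hG, mul_one]
    · rw [hs _ hl, hS]

variable [NormedAddCommGroup E] [NormedSpace ℝ E]

/-- The linear relations of the configuration obtained from the points `a j`, grouped by `g`, by the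
Cayley trick. -/
noncomputable def cayleyKer (g : J → ι) (a : J → E) : Submodule ℝ (J → ℝ) :=
  LinearMap.ker (fiberSum g) ⊓ LinearMap.ker (Fintype.linearCombination ℝ a)

/-- The combinations of the points `a j` whose weights have support `S` and fibre sums `l`. -/
noncomputable def cell (g : J → ι) (a : J → E) (S : Set J) (l : ι → ℝ) : Set E :=
  Fintype.linearCombination ℝ a '' {t ∈ fiberWeights g l | Function.support t = S}

theorem linearIndependent_edges {g : J → ι} {a : J → E} {S : Set J}
    (hS : ∀ k ∈ cayleyKer g a, Function.support k ⊆ S → k = 0)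
    {f : ι → J} (hfS : ∀ i, f i ∈ S) (hf : ∀ i, g (f i) = i) :
    LinearIndependent ℝ fun j : {j // j ∈ S ∧ j ≠ f (g j)} => a j - a (f (g j)) := by
  classical
  rw [Fintype.linearIndependent_iff]
  intro c hc j₀
  set k : J → ℝ := ∑ j : {j // j ∈ S ∧ j ≠ f (g j)},
    c j • (Pi.single (j : J) 1 - Pi.single (f (g j)) 1) with hk
  have hk0 : k = 0 := by
    refine hS k ⟨?_, ?_⟩ fun j hj => ?_
    · simp [hk, LinearMap.mem_ker, fiberSum, Fintype.linearCombination_apply_single, hf]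
    · simpa [hk, LinearMap.mem_ker, Fintype.linearCombination_apply_single] using hc
    · by_contra hjS
      refine hj ?_
      simp only [hk, Finset.sum_apply]
      refine Finset.sum_eq_zero fun j' _ => ?_
      have h1 : j ≠ j' := fun h => hjS (h ▸ j'.2.1)
      have h2 : j ≠ f (g j') := fun h => hjS (h ▸ hfS _)
      simp [h1, h2]
  have := congrFun hk0 j₀
  simp only [hk, Finset.sum_apply] at this
  rw [Finset.sum_eq_single j₀] at this
  · simpa [j₀.2.2] using this
  · intro j' _ hj'
    have h1 : (j₀ : J) ≠ j' := fun h => hj' (Subtype.ext h.symm)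
    have h2 : (j₀ : J) ≠ f (g j') := fun h => j₀.2.2 (by
      have h3 : g j₀ = g j' := by rw [h, hf]
      rw [h3]; exact h)
    simp [h1, h2]
  · simp

theorem linearCombination_eq_add [Fintype ι] (g : J → ι) (a : J → E) (f : ι → J) (t : J → ℝ) :
    Fintype.linearCombination ℝ a t = Fintype.linearCombination ℝ (a ∘ f) (fiberSum g t) +
      Fintype.linearCombination ℝ (fun j => a j - a (f (g j))) t := by
  rw [fiberSum, Fintype.linearCombination_apply ℝ (fun j => Pi.single (g j) 1) t,
    map_sum (Fintype.linearCombination ℝ (a ∘ f))]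
  simp_rw [map_smul, Fintype.linearCombination_apply_single, Fintype.linearCombination_apply,
    ← Finset.sum_add_distrib]
  exact Finset.sum_congr rfl fun j _ => by simp [smul_sub]

variable [MeasurableSpace E] [BorelSpace E]

theorem measurableSet_cell {g : J → ι} {a : J → E} {S : Set J}
    (hS : ∀ k ∈ cayleyKer g a, Function.support k ⊆ S → k = 0) (l : ι → ℝ) :
    MeasurableSet (cell g a S l) := by
  refine MeasurableSet.image_of_continuousOn_injOn ?_
    (LinearMap.continuous_of_finiteDimensional _).continuousOn ?_
  · refine (isClosed_fiberWeights g l).measurableSet.inter ?_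
    have : {t : J → ℝ | Function.support t = S} =
        ⋂ j, (fun t : J → ℝ => t j) ⁻¹' {x | x ≠ 0 ↔ j ∈ S} := by
      ext t
      simp [Set.ext_iff]
    change MeasurableSet {t : J → ℝ | Function.support t = S}
    rw [this]
    refine MeasurableSet.iInter fun j => measurable_pi_apply j ?_
    by_cases hj : j ∈ S
    · simp only [hj, iff_true]
      exact (measurableSet_singleton (0 : ℝ)).compl
    · simp [hj]
  · rintro t ⟨ht, htS⟩ t' ⟨ht', htS'⟩ h
    refine sub_eq_zero.1 (hS (t - t') ⟨?_, ?_⟩ fun j hj => ?_)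
    · simp [LinearMap.mem_ker, ht.2, ht'.2]
    · simp [LinearMap.mem_ker, h]
    · by_contra hjS
      have h1 : t j = 0 := Function.notMem_support.1 (by rwa [htS])
      have h2 : t' j = 0 := Function.notMem_support.1 (by rwa [htS'])
      exact hj (by simp [h1, h2])

variable [Fintype ι] [FiniteDimensional ℝ E]

variable (μ : Measure E) [μ.IsAddHaarMeasure]

theorem measure_cell_eq_zero {g : J → ι} {a : J → E} {S : Set J} {f : ι → J}
    (hspan : Submodule.span ℝ (Set.range fun j : {j // j ∈ S ∧ j ≠ f (g j)} =>
      a j - a (f (g j))) ≠ ⊤) (l : ι → ℝ) : μ (cell g a S l) = 0 := by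
  set V :=
    Submodule.span ℝ (Set.range fun j : {j // j ∈ S ∧ j ≠ f (g j)} => a j - a (f (g j)))
  have hsub : cell g a S l ⊆
      (-Fintype.linearCombination ℝ (a ∘ f) l + ·) ⁻¹' (V : Set E) := by
    rintro _ ⟨t, ⟨⟨-, ht⟩, htS⟩, rfl⟩
    rw [Set.mem_preimage, linearCombination_eq_add g a f, ht, neg_add_cancel_left,
      Fintype.linearCombination_apply]
    refine V.sum_mem fun j _ => ?_
    by_cases hj : j = f (g j)
    · simp [← hj]
    · by_cases hjS : j ∈ S
      · exact V.smul_mem _ (Submodule.subset_span ⟨⟨j, hjS, hj⟩, rfl⟩)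
      · rw [← htS, Function.notMem_support] at hjS
        simp [hjS]
  refine measure_mono_null hsub ?_
  rw [measure_preimage_add]
  exact Measure.addHaar_submodule μ V hspan

theorem measure_cell_eq_mul {g : J → ι} {a : J → E} {S : Set J}
    (hS : ∀ k ∈ cayleyKer g a, Function.support k ⊆ S → k = 0)
    {f : ι → J} (hfS : ∀ i, f i ∈ S) (hf : ∀ i, g (f i) = i)
    (hspan : Submodule.span ℝ (Set.range fun j : {j // j ∈ S ∧ j ≠ f (g j)} =>
      a j - a (f (g j))) = ⊤) [Fintype {j // j ∈ S ∧ j ≠ f (g j)}]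
    {l : ι → ℝ} (hl : ∀ i, 0 < l i) :
    μ (cell g a S l) =
      ENNReal.ofReal (∏ j : {j // j ∈ S ∧ j ≠ f (g j)}, l (g j)) * μ (cell g a S 1) := by
  classical
  let b := Module.Basis.mk (linearIndependent_edges hS hfS hf) hspan.ge
  have hb : ∀ j, b j = a j - a (f (g j)) := fun j => by simp [b]
  let D : E →ₗ[ℝ] E := b.constr ℝ fun j => l (g j) • b j
  have hD : ∀ j, D (b j) = l (g j) • b j := fun j => by simp [D]
  have hdet : LinearMap.det D = ∏ j : {j // j ∈ S ∧ j ≠ f (g j)}, l (g j) := by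
    rw [← LinearMap.det_toMatrix b, ← Matrix.det_diagonal]
    congr 1
    ext i j
    rw [LinearMap.toMatrix_apply, hD]
    by_cases hij : i = j
    · simp [hij]
    · simp [hij]
  set V := Fintype.linearCombination ℝ (a ∘ f)
  have hcell : cell g a S l = (V l + ·) '' (D '' ((-V 1 + ·) '' cell g a S 1)) := by
    rw [cell, cell, fiberWeights_support_eq_image g hl, Set.image_image, Set.image_image,
      Set.image_image, Set.image_image]
    refine Set.image_congr fun t ht => ?_
    obtain ⟨⟨-, ht⟩, htS⟩ := ht
    rw [linearCombination_eq_add g a f, linearCombination_eq_add g a f t, fiberSum_mul, ht,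
      mul_one, neg_add_cancel_left,
      Fintype.linearCombination_apply ℝ (fun j => a j - a (f (g j))),
      Fintype.linearCombination_apply ℝ (fun j => a j - a (f (g j))), map_sum]
    congr 1
    refine Finset.sum_congr rfl fun j _ => ?_
    by_cases hj : j = f (g j)
    · simp [← hj]
    · by_cases hjS : j ∈ S
      · have := hD ⟨j, hjS, hj⟩
        rw [hb] at this
        rw [map_smul, this, smul_smul, mul_comm (t j)]
        rfl
      · rw [← htS, Function.notMem_support] at hjS
        simp [hjS]
  have hpos : 0 ≤ ∏ j : {j // j ∈ S ∧ j ≠ f (g j)}, l (g j) :=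
    Finset.prod_nonneg fun j _ => (hl _).le
  rw [hcell, Set.image_add_left, measure_preimage_add, Measure.addHaar_image_linearMap,
    Set.image_add_left, measure_preimage_add, hdet, abs_of_nonneg hpos]

theorem exists_mvPolynomial_measure_cell {g : J → ι} {a : J → E} {S : Set J}
    (hS : ∀ k ∈ cayleyKer g a, Function.support k ⊆ S → k = 0) :
    ∃ Q : MvPolynomial ι ℝ, Q.IsHomogeneous (Module.finrank ℝ E) ∧ (∀ m, 0 ≤ Q.coeff m) ∧
      ∀ l : ι → ℝ, (∀ i, 0 < l i) → MvPolynomial.eval l Q = (μ (cell g a S l)).toReal := by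
  classical
  by_cases hex : ∀ i, ∃ j ∈ S, g j = i
  swap
  · refine ⟨0, MvPolynomial.isHomogeneous_zero _ _ _, by simp, fun l hl => ?_⟩
    have : cell g a S l = ∅ := by
      refine Set.eq_empty_of_forall_notMem ?_
      rintro _ ⟨t, ⟨⟨-, ht⟩, htS⟩, rfl⟩
      push Not at hex
      obtain ⟨i, hi⟩ := hex
      refine (hl i).ne' ?_
      rw [← ht, fiberSum_apply]
      refine Finset.sum_eq_zero fun j _ => ?_
      split_ifs with hj
      · exact Function.notMem_support.1 fun h => hi j (htS ▸ h) hj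
      · rfl
    simp [this]
  choose f hfS hf using hex
  by_cases hspan : Submodule.span ℝ (Set.range fun j : {j // j ∈ S ∧ j ≠ f (g j)} =>
      a j - a (f (g j))) = ⊤
  swap
  · exact ⟨0, MvPolynomial.isHomogeneous_zero _ _ _, by simp, fun l _ => by
      simp [measure_cell_eq_zero μ hspan l]⟩
  refine ⟨MvPolynomial.monomial
    (∑ j : {j // j ∈ S ∧ j ≠ f (g j)}, Finsupp.single (g j) 1) (μ (cell g a S 1)).toReal,
    MvPolynomial.isHomogeneous_monomial _ ?_, fun m => ?_, fun l hl => ?_⟩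
  · rw [map_sum]
    simp only [Finsupp.degree_single, Finset.sum_const, smul_eq_mul, mul_one, Finset.card_univ]
    exact (Module.finrank_eq_card_basis
      (Module.Basis.mk (linearIndependent_edges hS hfS hf) hspan.ge)).symm
  · rw [MvPolynomial.coeff_monomial]
    split_ifs <;> simp
  · rw [measure_cell_eq_mul μ hS hfS hf hspan hl, ENNReal.toReal_mul, ENNReal.toReal_ofReal
      (Finset.prod_nonneg fun j _ => (hl _).le), MvPolynomial.eval_monomial, mul_comm]
    congr 1
    rw [← Finsupp.prod_finsetSum_index (by simp) (by intros; rw [pow_add])]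
    simp

end Cell

section MinkowskiSum

variable {ι E : Type*} [Fintype ι] [NormedAddCommGroup E] [NormedSpace ℝ E]

theorem sum_smul_convexHull_eq_image_fiberWeights [DecidableEq ι] (A : ι → Finset E) {l : ι → ℝ}
    (hl : ∀ i, 0 < l i) :
    ∑ i, l i • convexHull ℝ (A i : Set E) =
      Fintype.linearCombination ℝ (fun j : Σ i, A i => (j.2 : E)) ''
        fiberWeights Sigma.fst l := by
  have hfib : ∀ (t : (Σ i, A i) → ℝ) i, fiberSum Sigma.fst t i = ∑ y : A i, t ⟨i, y⟩ := by
    intro t i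
    rw [fiberSum_apply, Fintype.sum_sigma, Finset.sum_eq_single i]
    · simp
    · intro i' _ hi'
      simp [hi']
    · simp
  ext x
  rw [Set.mem_fintype_sum]
  constructor
  · rintro ⟨p, hp, rfl⟩
    have hw : ∀ i, ∃ w : E → ℝ, (∀ y ∈ A i, 0 ≤ w y) ∧ ∑ y ∈ A i, w y = 1 ∧
        l i • ∑ y ∈ A i, w y • y = p i := fun i => by
      obtain ⟨q, hq, hqp⟩ := hp i
      obtain ⟨w, h1, h2, rfl⟩ := Finset.mem_convexHull'.1 hq
      exact ⟨w, h1, h2, hqp⟩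
    choose w hw0 hw1 hwp using hw
    refine ⟨fun j => l j.1 * w j.1 j.2, ⟨fun j => mul_nonneg (hl _).le (hw0 _ _ j.2.2), ?_⟩, ?_⟩
    · ext i
      rw [hfib]
      dsimp only
      rw [← Finset.mul_sum, Finset.sum_coe_sort (A i) (w i), hw1, mul_one]
    · rw [Fintype.linearCombination_apply, Fintype.sum_sigma]
      refine Finset.sum_congr rfl fun i _ => ?_
      simp_rw [mul_smul, ← Finset.smul_sum]
      rw [Finset.sum_coe_sort (A i) fun y => w i y • y, hwp]
  · rintro ⟨t, ⟨ht, htl⟩, rfl⟩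
    refine ⟨fun i => ∑ y : A i, t ⟨i, y⟩ • (y : E), fun i => ?_, ?_⟩
    · rw [Set.mem_smul_set_iff_inv_smul_mem₀ (hl i).ne', Finset.smul_sum]
      simp_rw [smul_smul]
      refine (convex_convexHull ℝ _).sum_mem
        (fun y _ => mul_nonneg (inv_nonneg.2 (hl i).le) (ht _)) ?_
        fun y _ => subset_convexHull ℝ _ y.2
      rw [← Finset.mul_sum, ← hfib, htl, inv_mul_cancel₀ (hl i).ne']
    · rw [Fintype.linearCombination_apply, Fintype.sum_sigma]

theorem isCompact_sum_smul {C : ι → Set E} (hC : ∀ i, IsCompact (C i)) (l : ι → ℝ) :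
    IsCompact (∑ i, l i • C i) :=
  Finset.sum_induction _ IsCompact (fun _ _ => IsCompact.add) isCompact_singleton
    fun i _ => (hC i).smul (l i)

variable [MeasurableSpace E] [BorelSpace E] [FiniteDimensional ℝ E]
  (μ : Measure E) [μ.IsAddHaarMeasure]

theorem exists_mvPolynomial_measure_image_fiberWeights [DecidableEq ι] {J : Type*} [Fintype J]
    (g : J → ι) (a : J → E) :
    ∃ Q : MvPolynomial ι ℝ, Q.IsHomogeneous (Module.finrank ℝ E) ∧ (∀ m, 0 ≤ Q.coeff m) ∧
      ∀ l : ι → ℝ, (∀ i, 0 < l i) → MvPolynomial.eval l Q =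
        (μ (Fintype.linearCombination ℝ a '' fiberWeights g l)).toReal := by
  classical
  obtain ⟨w, hw⟩ := exists_isGenericFor (cayleyKer g a)
  have hind : ∀ S, IsOptimalSupport (cayleyKer g a) w S →
      ∀ k ∈ cayleyKer g a, Function.support k ⊆ S → k = 0 :=
    fun S hS k hk hkS => hS.eq_zero_of_support_subset hw hk hkS
  choose Q hQhom hQnn hQ using fun S : {S // IsOptimalSupport (cayleyKer g a) w S} =>
    exists_mvPolynomial_measure_cell μ (hind S S.2)
  refine ⟨∑ S, Q S, MvPolynomial.IsHomogeneous.sum _ _ _ fun S _ => hQhom S, fun m => ?_,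
    fun l hl => ?_⟩
  · rw [MvPolynomial.coeff_sum]
    exact Finset.sum_nonneg fun S _ => hQnn S m
  have hcont : Continuous (Fintype.linearCombination ℝ a) :=
    LinearMap.continuous_of_finiteDimensional _
  have hcompact : IsCompact (Fintype.linearCombination ℝ a '' fiberWeights g l) :=
    (Metric.isCompact_of_isClosed_isBounded (isClosed_fiberWeights g l)
      (isBounded_fiberWeights g l)).image hcont
  have hsub : ∀ S, cell g a S l ⊆ Fintype.linearCombination ℝ a '' fiberWeights g l :=
    fun S => Set.image_mono fun t ht => ht.1
  have hunion : Fintype.linearCombination ℝ a '' fiberWeights g l =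
      ⋃ S ∈ (Finset.univ : Finset {S // IsOptimalSupport (cayleyKer g a) w S}),
        cell g a S l := by
    refine subset_antisymm ?_ (Set.iUnion₂_subset fun S _ => hsub S)
    rintro _ ⟨t₀, ⟨ht₀, hG₀⟩, rfl⟩
    have hfib : ∀ t, t - t₀ ∈ cayleyKer g a → fiberSum g t = l := fun t ht => by
      have := LinearMap.mem_ker.1 ht.1
      rwa [map_sub, hG₀, sub_eq_zero] at this
    obtain ⟨t, ht, htK, htS⟩ := exists_isOptimalSupport (cayleyKer g a) w ht₀
      ((isBounded_fiberWeights g l).subset fun t ht => ⟨ht.1, hfib t ht.2⟩)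
    refine Set.mem_iUnion₂.2 ⟨⟨_, htS⟩, Finset.mem_univ _, t, ⟨⟨ht, hfib t htK⟩, rfl⟩, ?_⟩
    have := LinearMap.mem_ker.1 htK.2
    rwa [map_sub, sub_eq_zero] at this
  have hdisj : ((Finset.univ : Finset {S // IsOptimalSupport (cayleyKer g a) w S}) :
      Set {S // IsOptimalSupport (cayleyKer g a) w S}).PairwiseDisjoint
        fun S => cell g a S l := by
    rintro ⟨S, hS⟩ - ⟨S', hS'⟩ - hne
    refine Set.disjoint_left.2 ?_
    rintro _ ⟨t, ⟨⟨ht, hG⟩, rfl⟩, rfl⟩ ⟨t', ⟨⟨ht', hG'⟩, rfl⟩, hx⟩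
    refine hne ?_
    have : t' = t := hS.eq_of_sub_mem hw ht ht' hS' ⟨?_, ?_⟩
    · simp [this]
    · simp [LinearMap.mem_ker, hG, hG']
    · simp [LinearMap.mem_ker, hx]
  rw [map_sum, hunion, measure_biUnion_finset hdisj fun S _ => measurableSet_cell (hind S S.2) l,
    ENNReal.toReal_sum fun (S : {S // IsOptimalSupport (cayleyKer g a) w S}) _ =>
      measure_ne_top_of_subset (hsub S) hcompact.measure_ne_top]
  exact Finset.sum_congr rfl fun S _ => hQ S l hl

theorem tendsto_measure_sum_smul {C : ι → Set E} (hC : ∀ i, IsCompact (C i))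
    (hconv : ∀ i, Convex ℝ (C i)) (hne : ∀ i, (C i).Nonempty) {l : ι → ℝ} (hl : ∀ i, 0 ≤ l i) :
    Filter.Tendsto (fun ε : ℝ => μ (∑ i, (l i + ε) • C i)) (nhdsWithin 0 (Set.Ioi 0))
      (nhds (μ (∑ i, l i • C i))) := by
  have hB : IsCompact (∑ i, C i) := by simpa using isCompact_sum_smul hC 1
  obtain ⟨R, hR⟩ := hB.isBounded.exists_norm_le
  have hadd : ∀ ε : ℝ, 0 < ε → ∑ i, (l i + ε) • C i = ∑ i, l i • C i + ε • ∑ i, C i := by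
    intro ε hε
    rw [Finset.smul_sum, ← Finset.sum_add_distrib]
    exact Finset.sum_congr rfl fun i _ => (hconv i).add_smul (hl i) hε.le
  choose p hp using hne
  have hp' : ∑ i, p i ∈ ∑ i, C i := (Set.mem_fintype_sum _ _).2 ⟨p, hp, rfl⟩
  have hupper : Filter.Tendsto (fun ε : ℝ => μ (Metric.cthickening (ε * R) (∑ i, l i • C i)))
      (nhdsWithin 0 (Set.Ioi 0)) (nhds (μ (∑ i, l i • C i))) := by
    refine (tendsto_measure_cthickening_of_isCompact (isCompact_sum_smul hC l)).comp ?_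
    have : Filter.Tendsto (fun ε : ℝ => ε * R) (nhds 0) (nhds (0 * R)) :=
      Continuous.tendsto (by fun_prop) 0
    rw [zero_mul] at this
    exact this.mono_left nhdsWithin_le_nhds
  refine tendsto_of_tendsto_of_tendsto_of_le_of_le' tendsto_const_nhds hupper ?_ ?_
  · filter_upwards [self_mem_nhdsWithin] with ε hε
    rw [hadd ε hε, ← measure_preimage_add_right μ (-(ε • ∑ i, p i)) (∑ i, l i • C i)]
    refine measure_mono fun x hx => ?_
    exact ⟨_, hx, _, Set.smul_mem_smul_set hp', by simp⟩
  · filter_upwards [self_mem_nhdsWithin] with ε hε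
    rw [hadd ε hε]
    refine measure_mono ?_
    rintro _ ⟨x, hx, _, ⟨b, hb, rfl⟩, rfl⟩
    refine Metric.mem_cthickening_of_dist_le _ x _ _ hx ?_
    rw [dist_eq_norm]
    simp only [add_sub_cancel_left, norm_smul, Real.norm_of_nonneg (le_of_lt hε)]
    exact mul_le_mul_of_nonneg_left (hR b hb) (le_of_lt hε)

theorem exists_mvPolynomial_measure_sum_smul_convexHull (A : ι → Finset E)
    (hA : ∀ i, (A i).Nonempty) :
    ∃ Q : MvPolynomial ι ℝ, Q.IsHomogeneous (Module.finrank ℝ E) ∧ (∀ m, 0 ≤ Q.coeff m) ∧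
      ∀ l : ι → ℝ, (∀ i, 0 ≤ l i) →
        MvPolynomial.eval l Q = (μ (∑ i, l i • convexHull ℝ (A i : Set E))).toReal := by
  classical
  obtain ⟨Q, hhom, hnn, hQ⟩ := exists_mvPolynomial_measure_image_fiberWeights μ Sigma.fst
    fun j : Σ i, A i => (j.2 : E)
  refine ⟨Q, hhom, hnn, fun l hl => ?_⟩
  have hC : ∀ i, IsCompact (convexHull ℝ (A i : Set E)) :=
    fun i => (A i).finite_toSet.isCompact_convexHull ℝ
  have hlim := (ENNReal.tendsto_toReal (isCompact_sum_smul hC l).measure_ne_top).comp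
    (tendsto_measure_sum_smul μ hC (fun i => convex_convexHull ℝ _)
      (fun i => (Finset.coe_nonempty.2 (hA i)).convexHull) hl)
  have hpoly : Filter.Tendsto (fun ε : ℝ => MvPolynomial.eval (fun i => l i + ε) Q)
      (nhdsWithin 0 (Set.Ioi 0)) (nhds (MvPolynomial.eval l Q)) := by
    have hc : Continuous fun ε : ℝ => MvPolynomial.eval (fun i => l i + ε) Q :=
      (MvPolynomial.continuous_eval Q).comp (by fun_prop)
    simpa using (hc.tendsto 0).mono_left nhdsWithin_le_nhds
  refine tendsto_nhds_unique (hpoly.congr' ?_) hlim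
  filter_upwards [self_mem_nhdsWithin] with ε hε
  have hpos : ∀ i, 0 < l i + ε := fun i => add_pos_of_nonneg_of_pos (hl i) hε
  rw [Function.comp_apply, hQ _ hpos, sum_smul_convexHull_eq_image_fiberWeights A hpos]

end MinkowskiSum

/-- For polytopes P₁,…,P_n ⊂ ℝⁿ, the function
Q(λ₁,…,λ_n) = Vol(λ₁P₁ + ⋯ + λ_nP_n), for λ_i ≥ 0, is a homogeneous polynomial
of degree n with nonnegative coefficients. -/
theorem minkowski_volume_polynomial (n : ℕ) (A : Fin n → Finset (Fin n → ℝ))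
    (hA : ∀ i, (A i).Nonempty) :
    ∃ Q : MvPolynomial (Fin n) ℝ, Q.IsHomogeneous n ∧
      (∀ m : Fin n →₀ ℕ, 0 ≤ Q.coeff m) ∧
      ∀ l : Fin n → ℝ, (∀ i, 0 ≤ l i) →
        MvPolynomial.eval l Q =
          (volume (∑ i, l i • convexHull ℝ ((A i : Set (Fin n → ℝ))))).toReal := by
  simpa only [Module.finrank_fin_fun] using
    exists_mvPolynomial_measure_sum_smul_convexHull volume A hA
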